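/- arXiv:1804.01086 — 9 statements merged into one kernel-verified Lean document; each statement's English description precedes it below -/
import Mathlib

section
/- Let q ≥ 2 be a prime power, let α be an integer with 0 ≤ α ≤ q²−3 and β ∈ {0,1}. Set n₁ = 1 + α(q³+1) + β(q²−q+1) and n₂ = q⁵ − 3q³ + 2q² − q − 1 − α(q³+1) − β(q²−q+1). Then for every integer t with 0 ≤ t ≤ q³, at least one of the following holds: (i) S(t) := ⌊(n₁+t)/(q³+1)⌋ + ⌊(n₂+t)/(q³+1)⌋ + (q−2)⌊t/(q³+1)⌋ + (q²−q)⌊t(q+1)/(q³+1)⌋ + ⌊−tq³/(q³+1)⌋ < 0; (ii) ⌊(n₁+t)/(q³+1)⌋ = ⌊(n₁−1+t)/(q³+1)⌋ and ⌊(n₂+t)/(q³+1)⌋ = ⌊(n₂−1+t)/(q³+1)⌋. (This is the arithmetic criterion expressing that (n₁,n₂) is a pure gap at any two distinct totally ramified places of the GK curve lying over zeros of x^q+x.) -/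
/-- Identify an integer quotient from a division-with-remainder expression. -/
theorem gk_ediv_eq {x M k r : ℤ} (h0 : 0 ≤ r) (h1 : r < M) (h : x = k * M + r) : x / M = k := by
  have hM : 0 < M := lt_of_le_of_lt h0 h1
  rw [h, add_comm, Int.add_mul_ediv_right _ _ hM.ne', Int.ediv_eq_zero_of_lt h0 h1, zero_add]

/-- Adding one to the numerator does not change the quotient away from multiples of `M`. -/
theorem gk_step {M a r t : ℤ} (h1 : 1 ≤ r + t) (h2 : r + t < 2 * M) (h3 : r + t ≠ M) :
    (a * M + r + t) / M = (a * M + r - 1 + t) / M := by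
  rcases lt_or_gt_of_ne h3 with h | h
  · rw [gk_ediv_eq (k := a) (r := r + t) (by linarith) h (by ring),
      gk_ediv_eq (k := a) (r := r + t - 1) (by linarith) (by linarith) (by ring)]
  · rw [gk_ediv_eq (k := a + 1) (r := r + t - M) (by linarith) (by linarith) (by ring),
      gk_ediv_eq (k := a + 1) (r := r + t - 1 - M) (by omega) (by linarith) (by ring)]

/-- The core computation, with the residues of the two entries normalised. -/
theorem gk_core (q a b r s n₁ n₂ t : ℤ) (hq : 2 ≤ q) (hab : a + b = q ^ 2 - 3)
    (hrs : (r = 1 ∧ s = q ^ 2 - q + 2) ∨ (r = q ^ 2 - q + 2 ∧ s = 1))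
    (hn₁ : n₁ = a * (q ^ 3 + 1) + r) (hn₂ : n₂ = b * (q ^ 3 + 1) + s)
    (ht0 : 0 ≤ t) (ht1 : t ≤ q ^ 3) :
      ((n₁ + t) / (q ^ 3 + 1) + (n₂ + t) / (q ^ 3 + 1)
          + (q - 2) * (t / (q ^ 3 + 1))
          + (q ^ 2 - q) * ((t * (q + 1)) / (q ^ 3 + 1))
          + (-(t * q ^ 3)) / (q ^ 3 + 1) < 0)
      ∨ ((n₁ + t) / (q ^ 3 + 1) = (n₁ - 1 + t) / (q ^ 3 + 1)
          ∧ (n₂ + t) / (q ^ 3 + 1) = (n₂ - 1 + t) / (q ^ 3 + 1)) := by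
  have hq2 : 2 * q ≤ q ^ 2 := by nlinarith
  have hq3 : 2 * q ^ 2 ≤ q ^ 3 := by nlinarith [mul_nonneg (sq_nonneg q) (sub_nonneg.2 hq)]
  have e1 : t / (q ^ 3 + 1) = 0 := Int.ediv_eq_zero_of_lt ht0 (by linarith)
  have e2 : (-(t * q ^ 3)) / (q ^ 3 + 1) = -t :=
    gk_ediv_eq (r := t) ht0 (by linarith) (by ring)
  rw [e1, e2]
  by_cases hA : t = q ^ 3
  · left
    have e3 : (t * (q + 1)) / (q ^ 3 + 1) = q :=
      gk_ediv_eq (r := q ^ 3 - q) (by linarith) (by linarith) (by rw [hA]; ring)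
    have e4 : (n₁ + t) / (q ^ 3 + 1) = a + 1 :=
      gk_ediv_eq (r := r - 1) (by rcases hrs with h | h <;> linarith [h.1])
        (by rcases hrs with h | h <;> linarith [h.1]) (by rw [hA, hn₁]; ring)
    have e5 : (n₂ + t) / (q ^ 3 + 1) = b + 1 :=
      gk_ediv_eq (r := s - 1) (by rcases hrs with h | h <;> linarith [h.2])
        (by rcases hrs with h | h <;> linarith [h.2]) (by rw [hA, hn₂]; ring)
    rw [e3, e4, e5, hA]
    nlinarith
  by_cases hB : t = q ^ 3 - q ^ 2 + q - 1
  · left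
    have e3 : (t * (q + 1)) / (q ^ 3 + 1) = q - 1 :=
      gk_ediv_eq (r := q ^ 3 - q) (by linarith) (by linarith) (by rw [hB]; ring)
    have e4 : (n₁ + t) / (q ^ 3 + 1) + (n₂ + t) / (q ^ 3 + 1) = a + b + 1 := by
      rcases hrs with ⟨hr, hs⟩ | ⟨hr, hs⟩
      · rw [gk_ediv_eq (x := n₁ + t) (k := a) (r := q ^ 3 - q ^ 2 + q) (by linarith)
            (by linarith) (by rw [hn₁, hr, hB]; ring),
          gk_ediv_eq (x := n₂ + t) (k := b + 1) (r := 0) (by linarith)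
            (by linarith) (by rw [hn₂, hs, hB]; ring)]
        ring
      · rw [gk_ediv_eq (x := n₂ + t) (k := b) (r := q ^ 3 - q ^ 2 + q) (by linarith)
            (by linarith) (by rw [hn₂, hs, hB]; ring),
          gk_ediv_eq (x := n₁ + t) (k := a + 1) (r := 0) (by linarith)
            (by linarith) (by rw [hn₁, hr, hB]; ring)]
        ring
    rw [e3, e4, hB]
    nlinarith
  · right
    rw [hn₁, hn₂]
    rcases hrs with ⟨hr, hs⟩ | ⟨hr, hs⟩
    all_goals
      constructor
      all_goals
        apply gk_step
        · linarith
        · linarith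
        · intro h
          first
          | exact hA (by linarith)
          | exact hB (by linarith)

/-- Arithmetic floor criterion expressing that
`(n₁, n₂) = (1 + α(q³+1) + β(q²−q+1), q⁵ − 3q³ + 2q² − q − 1 − α(q³+1) − β(q²−q+1))`
is a pure gap at two distinct totally ramified places of the GK curve lying over
zeros of `x^q + x`. -/
theorem gk_pure_gap_two_places (q α β n₁ n₂ : ℤ)
    (hq : 2 ≤ q) (hq' : IsPrimePow q)
    (hα : 0 ≤ α ∧ α ≤ q ^ 2 - 3) (hβ : β = 0 ∨ β = 1)
    (hn₁ : n₁ = 1 + α * (q ^ 3 + 1) + β * (q ^ 2 - q + 1))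
    (hn₂ : n₂ = q ^ 5 - 3 * q ^ 3 + 2 * q ^ 2 - q - 1
      - α * (q ^ 3 + 1) - β * (q ^ 2 - q + 1)) :
    ∀ t : ℤ, 0 ≤ t → t ≤ q ^ 3 →
      ((n₁ + t) / (q ^ 3 + 1) + (n₂ + t) / (q ^ 3 + 1)
          + (q - 2) * (t / (q ^ 3 + 1))
          + (q ^ 2 - q) * ((t * (q + 1)) / (q ^ 3 + 1))
          + (-(t * q ^ 3)) / (q ^ 3 + 1) < 0)
      ∨ ((n₁ + t) / (q ^ 3 + 1) = (n₁ - 1 + t) / (q ^ 3 + 1)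
          ∧ (n₂ + t) / (q ^ 3 + 1) = (n₂ - 1 + t) / (q ^ 3 + 1)) := by
  intro t ht0 ht1
  rcases hβ with hb | hb
  · exact gk_core q α (q ^ 2 - 3 - α) 1 (q ^ 2 - q + 2) n₁ n₂ t hq (by ring)
      (Or.inl ⟨rfl, rfl⟩) (by rw [hn₁, hb]; ring) (by rw [hn₂, hb]; ring) ht0 ht1
  · exact gk_core q α (q ^ 2 - 3 - α) (q ^ 2 - q + 2) 1 n₁ n₂ t hq (by ring)
      (Or.inr ⟨rfl, rfl⟩) (by rw [hn₁, hb]; ring) (by rw [hn₂, hb]; ring) ht0 ht1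
end

section
/- Let q ≥ 2 be a prime power. Set n₁ = 1 and n₂ = q⁵ − 2q³ + q² − 2 (which equals 2g−2 for the GK curve of genus g = (q³+1)(q²−2)/2 + 1). Then for every integer t with 0 ≤ t ≤ q³, at least one of the following holds: (i) S(t) := ⌊(n₁+t)/(q³+1)⌋ + ⌊(n₂+t)/(q³+1)⌋ + (q−2)⌊t/(q³+1)⌋ + (q²−q)⌊t(q+1)/(q³+1)⌋ + ⌊−tq³/(q³+1)⌋ < 0; (ii) ⌊(n₁+t)/(q³+1)⌋ = ⌊(n₁−1+t)/(q³+1)⌋. (This is the arithmetic criterion expressing that (1, 2g−2) is a (1,0)-gap at two distinct totally ramified places of the GK curve lying over zeros of x^q+x.) -/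
theorem gk_floor_aux (a m k : ℤ) (h1 : k * m ≤ a) (h2 : a < (k + 1) * m) (hm : 0 < m) :
    a / m = k := by
  apply le_antisymm
  · exact Int.lt_add_one_iff.mp (Int.ediv_lt_of_lt_mul hm h2)
  · exact (Int.le_ediv_iff_mul_le hm).mpr h1

/-- Arithmetic floor criterion expressing that `(1, 2g−2)` is a `(1,0)`-gap at two
distinct totally ramified places of the GK curve lying over zeros of `x^q + x`,
where `2g−2 = q⁵ − 2q³ + q² − 2`. -/
theorem gk_one_zero_gap (q n₁ n₂ : ℤ)
    (hq : 2 ≤ q) (hq' : IsPrimePow q)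
    (hn₁ : n₁ = 1)
    (hn₂ : n₂ = q ^ 5 - 2 * q ^ 3 + q ^ 2 - 2) :
    ∀ t : ℤ, 0 ≤ t → t ≤ q ^ 3 →
      ((n₁ + t) / (q ^ 3 + 1) + (n₂ + t) / (q ^ 3 + 1)
          + (q - 2) * (t / (q ^ 3 + 1))
          + (q ^ 2 - q) * ((t * (q + 1)) / (q ^ 3 + 1))
          + (-(t * q ^ 3)) / (q ^ 3 + 1) < 0)
      ∨ ((n₁ + t) / (q ^ 3 + 1) = (n₁ - 1 + t) / (q ^ 3 + 1)) := by
  intro t ht0 ht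
  subst hn₁ hn₂
  have h8 : q * 4 ≤ q ^ 3 := by nlinarith [mul_nonneg (by linarith : 0 ≤ q) (by nlinarith : 0 ≤ q ^ 2 - 4)]
  have hm : 0 < q ^ 3 + 1 := by linarith
  rcases lt_or_eq_of_le ht with h | h
  · right
    rw [gk_floor_aux (1 + t) _ 0 (by linarith) (by linarith) hm,
      gk_floor_aux (1 - 1 + t) _ 0 (by linarith) (by linarith) hm]
  · left
    subst h
    rw [gk_floor_aux (1 + q ^ 3) _ 1 (by linarith) (by linarith) hm,
      gk_floor_aux (q ^ 5 - 2 * q ^ 3 + q ^ 2 - 2 + q ^ 3) _ (q ^ 2 - 2)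
        (by ring_nf; linarith) (by ring_nf; linarith) hm,
      gk_floor_aux (q ^ 3) _ 0 (by linarith) (by linarith) hm,
      gk_floor_aux (q ^ 3 * (q + 1)) _ q (by ring_nf; linarith) (by ring_nf; linarith) hm,
      gk_floor_aux (-(q ^ 3 * q ^ 3)) _ (-q ^ 3) (by ring_nf; linarith) (by ring_nf; linarith) hm]
    ring_nf
    norm_num
end

section
/- Let q ≥ 2 be an even prime power and n ≥ 1 an integer. Set n₀ = 1 and n₁ = (qⁿ−2)(qⁿ+1). Then for every integer t with 0 ≤ t ≤ qⁿ, at least one of the following holds: (i) T(t) := ⌊(n₀ − tqⁿ(qⁿ−1))/(qⁿ+1)⌋ + ⌊(n₁ + t(qⁿ−1))/(qⁿ+1)⌋ + (qⁿ−1)⌊t(qⁿ−1)/(qⁿ+1)⌋ < 0; (ii) ⌊(n₀ − tqⁿ(qⁿ−1))/(qⁿ+1)⌋ = ⌊(n₀ − 1 − tqⁿ(qⁿ−1))/(qⁿ+1)⌋. (This is the arithmetic criterion expressing that (1, (qⁿ−2)(qⁿ+1)) is a (1,0)-gap at (P_∞, P₁) on the curve X₁.) -/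
/-- Arithmetic floor criterion expressing that `(1, (qⁿ−2)(qⁿ+1))` is a `(1,0)`-gap
at `(P_∞, P₁)` on the curve `X₁ : y^{qⁿ+1} = (x^{qⁿ}−x)^{qⁿ−1}`, for `q` an even
prime power. -/
theorem X1_one_zero_gap (q : ℤ) (n : ℕ) (n₀ n₁ : ℤ)
    (hq : 2 ≤ q) (hq' : IsPrimePow q) (hqeven : Even q) (hn : 1 ≤ n)
    (hn₀ : n₀ = 1) (hn₁ : n₁ = (q ^ n - 2) * (q ^ n + 1)) :
    ∀ t : ℤ, 0 ≤ t → t ≤ q ^ n →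
      ((n₀ - t * q ^ n * (q ^ n - 1)) / (q ^ n + 1)
          + (n₁ + t * (q ^ n - 1)) / (q ^ n + 1)
          + (q ^ n - 1) * ((t * (q ^ n - 1)) / (q ^ n + 1)) < 0)
      ∨ ((n₀ - t * q ^ n * (q ^ n - 1)) / (q ^ n + 1)
          = (n₀ - 1 - t * q ^ n * (q ^ n - 1)) / (q ^ n + 1)) := by
  intro t ht0 htQ
  have hev : Even (q ^ n) := hqeven.pow_of_ne_zero (by omega)
  have hpos : 0 < q ^ n := by positivity
  subst hn₀ hn₁
  generalize q ^ n = Q at *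
  obtain ⟨k, rfl⟩ := hev
  have key : ∀ a b r : ℤ, 0 ≤ r → r < k + k + 1 → a = r + b * (k + k + 1) →
      a / (k + k + 1) = b := by
    intro a b r h0 h1 h
    rw [h, Int.add_mul_ediv_right _ _ (by omega), Int.ediv_eq_zero_of_lt h0 h1, zero_add]
  rcases lt_trichotomy t (k + 1) with h | h | h
  · right
    rcases eq_or_lt_of_le ht0 with h' | h'
    · subst h'
      rw [key _ 0 1 (by omega) (by omega) (by ring), key _ 0 0 (by omega) (by omega) (by ring)]
    · rw [key _ (-1 - t * (k + k - 2)) (k + k + 2 - 2 * t) (by omega) (by omega) (by ring),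
        key _ (-1 - t * (k + k - 2)) (k + k + 1 - 2 * t) (by omega) (by omega) (by ring)]
  · left
    subst h
    rw [key _ (-1 - (k + 1) * (k + k - 2)) 0 (by omega) (by omega) (by ring),
      key _ (k + k - 2 + (k - 1)) (k + k) (by omega) (by omega) (by ring),
      key _ (k - 1) (k + k) (by omega) (by omega) (by ring)]
    ring_nf
    omega
  · right
    rw [key _ (-2 - t * (k + k - 2)) (2 * (k + k + 1) + 1 - 2 * t) (by omega) (by omega) (by ring),
      key _ (-2 - t * (k + k - 2)) (2 * (k + k + 1) - 2 * t) (by omega) (by omega) (by ring)]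
end

section
/- Let q ≥ 2 be an even prime power, n ≥ 1 an integer, and α ∈ {1,2}. Set n₀ = 1 and n₁ = (qⁿ−3)(qⁿ+1) + α. Then for every integer t with 0 ≤ t ≤ qⁿ, at least one of the following holds: (i) T(t) := ⌊(n₀ − tqⁿ(qⁿ−1))/(qⁿ+1)⌋ + ⌊(n₁ + t(qⁿ−1))/(qⁿ+1)⌋ + (qⁿ−1)⌊t(qⁿ−1)/(qⁿ+1)⌋ < 0; (ii) ⌊(n₀ − tqⁿ(qⁿ−1))/(qⁿ+1)⌋ = ⌊(n₀ − 1 − tqⁿ(qⁿ−1))/(qⁿ+1)⌋ and ⌊(n₁ + t(qⁿ−1))/(qⁿ+1)⌋ = ⌊(n₁ − 1 + t(qⁿ−1))/(qⁿ+1)⌋. (This is the arithmetic criterion expressing that (1, (qⁿ−3)(qⁿ+1)+α) is a pure gap at (P_∞, P₁) on the curve X₁.) -/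
theorem floor_aux (M x c r : ℤ) (h : x = r + c * M) (h0 : 0 ≤ r) (h1 : r < M) : x / M = c := by
  have hM : M ≠ 0 := by omega
  rw [h, Int.add_mul_ediv_right _ _ hM, Int.ediv_eq_zero_of_lt h0 h1, zero_add]

/-- Arithmetic floor criterion expressing that `(1, (qⁿ−3)(qⁿ+1)+α)` with `α ∈ {1,2}`
is a pure gap at `(P_∞, P₁)` on the curve `X₁ : y^{qⁿ+1} = (x^{qⁿ}−x)^{qⁿ−1}`, for
`q` an even prime power. -/
theorem X1_pure_gap (q : ℤ) (n : ℕ) (α n₀ n₁ : ℤ)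
    (hq : 2 ≤ q) (hq' : IsPrimePow q) (hqeven : Even q) (hn : 1 ≤ n)
    (hα : α = 1 ∨ α = 2)
    (hn₀ : n₀ = 1) (hn₁ : n₁ = (q ^ n - 3) * (q ^ n + 1) + α) :
    ∀ t : ℤ, 0 ≤ t → t ≤ q ^ n →
      ((n₀ - t * q ^ n * (q ^ n - 1)) / (q ^ n + 1)
          + (n₁ + t * (q ^ n - 1)) / (q ^ n + 1)
          + (q ^ n - 1) * ((t * (q ^ n - 1)) / (q ^ n + 1)) < 0)
      ∨ ((n₀ - t * q ^ n * (q ^ n - 1)) / (q ^ n + 1)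
          = (n₀ - 1 - t * q ^ n * (q ^ n - 1)) / (q ^ n + 1)
        ∧ (n₁ + t * (q ^ n - 1)) / (q ^ n + 1)
          = (n₁ - 1 + t * (q ^ n - 1)) / (q ^ n + 1)) := by
  subst hn₀ hn₁
  have hev : Even (q ^ n) := hqeven.pow_of_ne_zero (by omega)
  have hQ : 2 ≤ q ^ n := le_trans hq (le_self_pow₀ (by omega) (by omega))
  generalize q ^ n = Q at *
  obtain ⟨k, hk⟩ := hev
  have hα1 : 1 ≤ α := by omega
  have hα2 : α ≤ 2 := by omega
  intro t ht0 htQ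
  -- the floors, given the floors of the residual parts
  have hA : ∀ e c : ℤ, 0 ≤ e - 2 * t - c * (Q + 1) → e - 2 * t - c * (Q + 1) < Q + 1 →
      (e - t * Q * (Q - 1)) / (Q + 1) = c - t * (Q - 2) := fun e c h1 h2 =>
    floor_aux _ _ _ _ (by ring) h1 h2
  have hB : ∀ e c : ℤ, 0 ≤ e - 2 * t - c * (Q + 1) → e - 2 * t - c * (Q + 1) < Q + 1 →
      ((Q - 3) * (Q + 1) + e + t * (Q - 1)) / (Q + 1) = c + Q - 3 + t := fun e c h1 h2 =>
    floor_aux _ _ _ _ (by ring) h1 h2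
  have hC : ∀ c : ℤ, 0 ≤ - 2 * t - c * (Q + 1) → - 2 * t - c * (Q + 1) < Q + 1 →
      (t * (Q - 1)) / (Q + 1) = c + t := fun c h1 h2 =>
    floor_aux _ _ _ _ (by ring) h1 h2
  have hA' := hA (1 - 1)
  have hB' := hB (α - 1)
  rw [← add_sub_assoc] at hB'
  have h2 : ∀ c : ℤ, 0 ≤ 1 - 1 - 2 * t - c * (Q + 1) → 1 - 2 * t - c * (Q + 1) < Q + 1 →
      0 ≤ α - 1 - 2 * t - c * (Q + 1) → α - 2 * t - c * (Q + 1) < Q + 1 →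
      ((1 - t * Q * (Q - 1)) / (Q + 1) = (1 - 1 - t * Q * (Q - 1)) / (Q + 1)
        ∧ ((Q - 3) * (Q + 1) + α + t * (Q - 1)) / (Q + 1)
          = ((Q - 3) * (Q + 1) + α - 1 + t * (Q - 1)) / (Q + 1)) := by
    intro c h1 h2 h3 h4
    rw [hA 1 c (by omega) (by omega), hA' c (by omega) (by omega),
      hB α c (by omega) (by omega), hB' c (by omega) (by omega)]
    exact ⟨rfl, rfl⟩
  by_cases c0 : t = 0
  · exact Or.inr (h2 0 (by omega) (by omega) (by omega) (by omega))
  by_cases c1 : t = 1 ∧ α = 2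
  · left
    rw [hA 1 (-1) (by omega) (by omega), hB α 0 (by omega) (by omega),
      hC (-1) (by omega) (by omega), c1.1]
    linarith
  by_cases c2 : t ≤ k
  · exact Or.inr (h2 (-1) (by omega) (by omega) (by omega) (by omega))
  by_cases c3 : t = k + 1
  · left
    rw [hA 1 (-1) (by omega) (by omega), hB α (-1) (by omega) (by omega),
      hC (-2) (by omega) (by omega)]
    have : -1 - t * (Q - 2) + (-1 + Q - 3 + t) + (Q - 1) * (-2 + t) = 2 * t - Q - 3 := by ring
    omega
  · exact Or.inr (h2 (-2) (by omega) (by omega) (by omega) (by omega))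
end

section
/- Let q > 3 be a prime power, let α be an integer with 0 ≤ α ≤ 2q−5 and β ∈ {0,1}. Set n₁ = q − 1 + α(q²−1) + βq and n₂ = 2q³ − 5q² + 4 − α(q²−1) − βq. Then for every integer t with 0 ≤ t ≤ q²−2, at least one of the following holds: (i) φ(t) := ⌊(n₁+tq)/(q²−1)⌋ + ⌊(n₂+tq)/(q²−1)⌋ + (q−3)⌊tq/(q²−1)⌋ + 2⌊t(q−1)/(q²−1)⌋ + (q−1)⌊−t/(q²−1)⌋ + ⌊−t(q²−1)/(q²−1)⌋ < 0; (ii) ⌊(n₁+tq)/(q²−1)⌋ = ⌊(n₁−1+tq)/(q²−1)⌋ and ⌊(n₂+tq)/(q²−1)⌋ = ⌊(n₂−1+tq)/(q²−1)⌋. (This is the arithmetic criterion expressing that (n₁,n₂) is a pure gap at two distinct totally ramified places of the curve X₂ lying over zeros of x^{q+1}+x+1.) -/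
theorem fl_aux (M x k : ℤ) (h1 : k * M ≤ x) (h2 : x < k * M + M) : x / M = k := by
  have hM : 0 < M := by linarith
  apply le_antisymm
  · have : x / M < k + 1 := by
      apply Int.ediv_lt_of_lt_mul hM
      linarith [add_mul k 1 M, one_mul M]
    linarith
  · exact (Int.le_ediv_iff_mul_le hM).2 h1

theorem jump_aux (M x : ℤ) (hM : 0 < M) (h : ¬ M ∣ x) : x / M = (x - 1) / M := by
  have h0 := Int.emod_nonneg x hM.ne'
  have h1 := Int.emod_lt_of_pos x hM
  have h2 := Int.mul_ediv_add_emod x M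
  have h3 : x % M ≠ 0 := fun h3 => h (Int.dvd_of_emod_eq_zero h3)
  have h4 : 1 ≤ x % M := by omega
  symm
  apply fl_aux <;> nlinarith

theorem zero_aux (M x : ℤ) (h : M ∣ x) (h1 : x < M) (h2 : -M < x) : x = 0 :=
  Int.eq_zero_of_abs_lt_dvd h (abs_lt.2 ⟨h2, h1⟩)

/-- Arithmetic floor criterion expressing that
`(n₁, n₂) = (q−1+α(q²−1)+βq, 2q³−5q²+4−α(q²−1)−βq)` is a pure gap at two distinct
totally ramified places of the curve `X₂` (with `m = q²−1`) lying over zeros of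
`x^{q+1}+x+1`, for a prime power `q > 3`. -/
theorem X2_pure_gap (q α β n₁ n₂ : ℤ)
    (hq : 3 < q) (hq' : IsPrimePow q)
    (hα : 0 ≤ α ∧ α ≤ 2 * q - 5) (hβ : β = 0 ∨ β = 1)
    (hn₁ : n₁ = q - 1 + α * (q ^ 2 - 1) + β * q)
    (hn₂ : n₂ = 2 * q ^ 3 - 5 * q ^ 2 + 4 - α * (q ^ 2 - 1) - β * q) :
    ∀ t : ℤ, 0 ≤ t → t ≤ q ^ 2 - 2 →
      ((n₁ + t * q) / (q ^ 2 - 1) + (n₂ + t * q) / (q ^ 2 - 1)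
          + (q - 3) * ((t * q) / (q ^ 2 - 1))
          + 2 * ((t * (q - 1)) / (q ^ 2 - 1))
          + (q - 1) * ((-t) / (q ^ 2 - 1))
          + (-(t * (q ^ 2 - 1))) / (q ^ 2 - 1) < 0)
      ∨ ((n₁ + t * q) / (q ^ 2 - 1) = (n₁ - 1 + t * q) / (q ^ 2 - 1)
          ∧ (n₂ + t * q) / (q ^ 2 - 1) = (n₂ - 1 + t * q) / (q ^ 2 - 1)) := by
  intro t ht0 ht1
  obtain ⟨hα0, hα1⟩ := hα
  have hM : 0 < q ^ 2 - 1 := by nlinarith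
  have hβ0 : 0 ≤ β ∧ β ≤ 1 := by omega
  by_cases ht : t = q - 1 ∨ t = q - 2
  · left
    have e3 : (t * q) / (q ^ 2 - 1) = 0 := by
      apply fl_aux <;> rcases ht with rfl | rfl <;> nlinarith
    have e4 : (t * (q - 1)) / (q ^ 2 - 1) = 0 := by
      apply fl_aux <;> rcases ht with rfl | rfl <;> nlinarith
    have e5 : (-t) / (q ^ 2 - 1) = -1 := by
      apply fl_aux <;> rcases ht with rfl | rfl <;> nlinarith
    have e6 : (-(t * (q ^ 2 - 1))) / (q ^ 2 - 1) = -t := by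
      apply fl_aux <;> nlinarith
    rw [e3, e4, e5, e6]
    rcases ht with rfl | rfl
    · have e1 : (n₁ + (q - 1) * q) / (q ^ 2 - 1) = α + 1 := by
        apply fl_aux <;> rcases hβ with rfl | rfl <;> subst hn₁ <;> nlinarith
      have e2 : (n₂ + (q - 1) * q) / (q ^ 2 - 1) = 2 * q - 5 - α + 1 := by
        apply fl_aux <;> rcases hβ with rfl | rfl <;> subst hn₂ <;> nlinarith
      rw [e1, e2]; linarith
    · have e1 : (n₁ + (q - 2) * q) / (q ^ 2 - 1) = α + β := by
        apply fl_aux <;> rcases hβ with rfl | rfl <;> subst hn₁ <;> nlinarith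
      have e2 : (n₂ + (q - 2) * q) / (q ^ 2 - 1) = 2 * q - 5 - α + (1 - β) := by
        apply fl_aux <;> rcases hβ with rfl | rfl <;> subst hn₂ <;> nlinarith
      rw [e1, e2]; linarith
  · right
    constructor
    · rw [show n₁ - 1 + t * q = n₁ + t * q - 1 by ring]
      apply jump_aux _ _ hM
      rintro ⟨c, hc⟩
      have hd : q ^ 2 - 1 ∣ t + β + 1 - q :=
        ⟨c * q - α * q - 1 - β - t + (0), by subst hn₁; linear_combination q * hc⟩
      have := zero_aux _ _ hd (by nlinarith) (by nlinarith)
      omega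
    · rw [show n₂ - 1 + t * q = n₂ + t * q - 1 by ring]
      apply jump_aux _ _ hM
      rintro ⟨c, hc⟩
      have hd : q ^ 2 - 1 ∣ t - β + 2 - q :=
        ⟨c * q - (2 * q - 5 - α) * q - 2 + β - t, by subst hn₂; linear_combination q * hc⟩
      have := zero_aux _ _ hd (by nlinarith) (by nlinarith)
      omega
end

section
/- Let q ≥ 2 be a prime power, n ≥ 5 an odd integer, α an integer with 0 ≤ α ≤ q²−3, and β ∈ {0,1}. Set n₁ = (β+1)q^{n−3}(q²−q+1) + α(qⁿ+1) and n₂ = (q²−3)(qⁿ+1) + 3q^{n−3}(q²−q+1) − (β+1)q^{n−3}(q²−q+1) − α(qⁿ+1). Then for every integer t with 0 ≤ t ≤ qⁿ, at least one of the following holds: (i) U(t) := ⌊(n₁+t)/(qⁿ+1)⌋ + ⌊(n₂+t)/(qⁿ+1)⌋ + (q−2)⌊t/(qⁿ+1)⌋ + (q²−q)⌊t(q+1)/(qⁿ+1)⌋ + ⌊−tq³/(qⁿ+1)⌋ < 0; (ii) ⌊(n₁+t)/(qⁿ+1)⌋ = ⌊(n₁−1+t)/(qⁿ+1)⌋ and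 ⌊(n₂+t)/(qⁿ+1)⌋ = ⌊(n₂−1+t)/(qⁿ+1)⌋. (This is the arithmetic criterion expressing that (n₁,n₂) is a pure gap at two distinct totally ramified places of the GGS curve lying over zeros of x^q+x.) -/
theorem ggs_div_eq (a b k r : ℤ) (h : a = k * b + r) (h0 : 0 ≤ r) (h1 : r < b) : a / b = k := by
  rw [h, add_comm, Int.add_mul_ediv_right _ _ (by omega), Int.ediv_eq_zero_of_lt h0 h1, zero_add]

theorem ggs_div_pred (a M c t : ℤ) (hc : 0 < c) (hcM : c < M) (ht0 : 0 ≤ t) (htM : t < M)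
    (hne : t ≠ M - c) : (a * M + c + t) / M = (a * M + c - 1 + t) / M := by
  rcases lt_or_gt_of_ne hne with h | h
  · rw [ggs_div_eq _ M a (c + t) (by ring) (by omega) (by omega),
      ggs_div_eq _ M a (c + t - 1) (by ring) (by omega) (by omega)]
  · rw [ggs_div_eq _ M (a + 1) (c + t - M) (by ring) (by omega) (by omega),
      ggs_div_eq _ M (a + 1) (c + t - M - 1) (by ring) (by omega) (by omega)]

theorem ggs_core (q s M c a b t : ℤ) (hq : 2 ≤ q) (hs : q ^ 2 ≤ s) (hM : M = s * q ^ 3 + 1)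
    (hc : c = s * (q ^ 2 - q + 1)) (hab : a + b = q ^ 2 - 3) (ht0 : 0 ≤ t) (htM : t < M) :
    ((a * M + c + t) / M + (b * M + 2 * c + t) / M + (q - 2) * (t / M)
          + (q ^ 2 - q) * ((t * (q + 1)) / M) + (-(t * q ^ 3)) / M < 0)
      ∨ ((a * M + c + t) / M = (a * M + c - 1 + t) / M
          ∧ (b * M + 2 * c + t) / M = (b * M + 2 * c - 1 + t) / M) := by
  have hs4 : 4 ≤ s := by nlinarith
  have hc0 : 0 < c := by rw [hc]; apply mul_pos <;> nlinarith
  have hq3 : 2 * (q ^ 2 - q + 1) < q ^ 3 := by nlinarith [mul_nonneg (sq_nonneg q) (sub_nonneg.2 hq)]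
  have h2c : 2 * c < M := by rw [hc, hM]; nlinarith
  have hqM : 2 * (q ^ 2 - q + 1) < M := by rw [hM]; nlinarith
  have hsM : 2 * s < M := by rw [hM]; nlinarith [sq_nonneg q]
  have hq1 : 1 ≤ q ^ 2 - q + 1 := by nlinarith
  have ht : t / M = 0 := Int.ediv_eq_zero_of_lt ht0 htM
  by_cases h1 : t = M - c
  · left
    rw [ht, ggs_div_eq (a * M + c + t) M (a + 1) 0 (by rw [h1]; ring) (by omega) (by omega),
      ggs_div_eq (b * M + 2 * c + t) M (b + 1) c (by rw [h1]; ring) (by omega) (by omega),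
      ggs_div_eq (t * (q + 1)) M (q - 1) (M + 1 - s) (by rw [h1, hc, hM]; ring)
        (by omega) (by omega),
      ggs_div_eq (-(t * q ^ 3)) M (-q ^ 3 + q ^ 2 - q) (M - (q ^ 2 - q + 1))
        (by rw [h1, hc, hM]; ring) (by linarith) (by linarith)]
    nlinarith
  by_cases h2 : t = M - 2 * c
  · left
    rw [ht, ggs_div_eq (a * M + c + t) M a (M - c) (by rw [h2]; ring) (by omega) (by omega),
      ggs_div_eq (b * M + 2 * c + t) M (b + 1) 0 (by rw [h2]; ring) (by omega) (by omega),
      ggs_div_eq (t * (q + 1)) M (q - 2) (M + 2 - 2 * s) (by rw [h2, hc, hM]; ring)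
        (by omega) (by omega),
      ggs_div_eq (-(t * q ^ 3)) M (-q ^ 3 + 2 * (q ^ 2 - q + 1) - 1) (M - 2 * (q ^ 2 - q + 1))
        (by rw [h2, hc, hM]; ring) (by linarith) (by linarith)]
    nlinarith
  right
  exact ⟨ggs_div_pred a M c t hc0 (by omega) ht0 htM h1,
    ggs_div_pred b M (2 * c) t (by omega) h2c ht0 htM h2⟩

/-- Arithmetic floor criterion expressing that
`(n₁, n₂) = ((β+1)q^{n−3}(q²−q+1)+α(qⁿ+1),
(q²−3)(qⁿ+1)+3q^{n−3}(q²−q+1)−(β+1)q^{n−3}(q²−q+1)−α(qⁿ+1))` is a pure gap at two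
distinct totally ramified places of the GGS curve lying over zeros of `x^q+x`. -/
theorem ggs_pure_gap_two_places (q : ℤ) (n : ℕ) (α β n₁ n₂ : ℤ)
    (hq : 2 ≤ q) (hq' : IsPrimePow q)
    (hn5 : 5 ≤ n) (hnodd : Odd n)
    (hα : 0 ≤ α ∧ α ≤ q ^ 2 - 3) (hβ : β = 0 ∨ β = 1)
    (hn₁ : n₁ = (β + 1) * q ^ (n - 3) * (q ^ 2 - q + 1) + α * (q ^ n + 1))
    (hn₂ : n₂ = (q ^ 2 - 3) * (q ^ n + 1) + 3 * q ^ (n - 3) * (q ^ 2 - q + 1)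
      - (β + 1) * q ^ (n - 3) * (q ^ 2 - q + 1) - α * (q ^ n + 1)) :
    ∀ t : ℤ, 0 ≤ t → t ≤ q ^ n →
      ((n₁ + t) / (q ^ n + 1) + (n₂ + t) / (q ^ n + 1)
          + (q - 2) * (t / (q ^ n + 1))
          + (q ^ 2 - q) * ((t * (q + 1)) / (q ^ n + 1))
          + (-(t * q ^ 3)) / (q ^ n + 1) < 0)
      ∨ ((n₁ + t) / (q ^ n + 1) = (n₁ - 1 + t) / (q ^ n + 1)
          ∧ (n₂ + t) / (q ^ n + 1) = (n₂ - 1 + t) / (q ^ n + 1)) := by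
  intro t ht0 ht1
  have hpow : q ^ n = q ^ (n - 3) * q ^ 3 := by rw [← pow_add]; congr 1; omega
  have hs : q ^ 2 ≤ q ^ (n - 3) := pow_le_pow_right₀ (by omega) (by omega)
  have hM : q ^ n + 1 = q ^ (n - 3) * q ^ 3 + 1 := by rw [hpow]
  have htM : t < q ^ n + 1 := by omega
  generalize q ^ n + 1 = M at *
  generalize q ^ (n - 3) = s at *
  rcases hβ with rfl | rfl
  · have e1 : n₁ = α * M + s * (q ^ 2 - q + 1) := by rw [hn₁]; ring
    have e2 : n₂ = (q ^ 2 - 3 - α) * M + 2 * (s * (q ^ 2 - q + 1)) := by rw [hn₂]; ring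
    rw [e1, e2]
    exact ggs_core q s M _ α (q ^ 2 - 3 - α) t hq hs hM rfl (by ring) ht0 htM
  · have e1 : n₁ = α * M + 2 * (s * (q ^ 2 - q + 1)) := by rw [hn₁]; ring
    have e2 : n₂ = (q ^ 2 - 3 - α) * M + s * (q ^ 2 - q + 1) := by rw [hn₂]; ring
    rw [e1, e2]
    rcases ggs_core q s M _ (q ^ 2 - 3 - α) α t hq hs hM rfl (by ring) ht0 htM with h | h
    · left; linarith
    · exact Or.inr ⟨h.2, h.1⟩
end

section
/- Let n ≥ 1 be an integer, q₀ = 2ⁿ and q = 2q₀². For every integer ε with 0 ≤ ε ≤ 2q₀−3, the natural number ε(q+2q₀+1) + 1 does not belong to the additive submonoid of ℕ generated by q, q+q₀, q+2q₀, and q+2q₀+1. Equivalently, there are no nonnegative integers A, B, C, D with ε(q+2q₀+1) + 1 = Aq + B(q+q₀) + C(q+2q₀) + D(q+2q₀+1). -/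
theorem suzuki_aux (m : ℕ) (hm : 2 ≤ m) (e A B C D : ℕ) (he : e + 3 ≤ 2 * m)
    (h : e * (2 * m ^ 2 + 2 * m + 1) + 1
      = A * (2 * m ^ 2) + B * (2 * m ^ 2 + m) + C * (2 * m ^ 2 + 2 * m)
        + D * (2 * m ^ 2 + 2 * m + 1)) : False := by
  have hD : D ≤ e := by
    by_contra hc
    have h1 : e + 1 ≤ D := by omega
    have h2 := Nat.mul_le_mul_right (2 * m ^ 2 + 2 * m + 1) h1
    have h3 : 0 < m ^ 2 := by positivity
    nlinarith [Nat.zero_le (A * (2 * m ^ 2)), Nat.zero_le (B * (2 * m ^ 2 + m)),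
      Nat.zero_le (C * (2 * m ^ 2 + 2 * m))]
  obtain ⟨d, rfl⟩ := Nat.exists_eq_add_of_le hD
  have h' : d * (2 * m ^ 2 + 2 * m + 1) + 1
      = A * (2 * m ^ 2) + B * (2 * m ^ 2 + m) + C * (2 * m ^ 2 + 2 * m) := by
    nlinarith
  have hdvd : m ∣ d + 1 := by
    have h1 : m ∣ d * (2 * m ^ 2 + 2 * m + 1) + 1 :=
      ⟨A * (2 * m) + B * (2 * m + 1) + C * (2 * m + 2), by rw [h']; ring⟩
    have h2 : d * (2 * m ^ 2 + 2 * m + 1) + 1 = m * (d * (2 * m + 2)) + (d + 1) := by ring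
    rw [h2] at h1
    exact (Nat.dvd_add_right (Dvd.intro _ rfl)).1 h1
  obtain ⟨k, hk⟩ := hdvd
  have hk1 : k = 1 := by
    have : k < 2 := by
      by_contra hc
      have := Nat.mul_le_mul_left m (show 2 ≤ k by omega)
      omega
    have : k ≠ 0 := by
      rintro rfl
      omega
    omega
  subst hk1
  have hdm : m = d + 1 := by omega
  subst hdm
  have h4 : (d + 1) * ((A + B + C) * (2 * (d + 1)) + (B + 2 * C) + 1)
      = (d + 1) * (2 * (d + 1) ^ 2) := by
    nlinarith
  have h5 := Nat.eq_of_mul_eq_mul_left (Nat.succ_pos d) h4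
  have h6 : A + B + C ≤ d := by
    by_contra hc
    have := Nat.mul_le_mul_right (2 * (d + 1)) (show d + 1 ≤ A + B + C by omega)
    nlinarith
  have := Nat.mul_le_mul_right (2 * (d + 1)) h6
  nlinarith

/-- For `q₀ = 2ⁿ` and `q = 2q₀²`, the number `ε(q+2q₀+1)+1` with `0 ≤ ε ≤ 2q₀−3` is
a gap of the Weierstrass semigroup `⟨q, q+q₀, q+2q₀, q+2q₀+1⟩` of the Suzuki
curve: it is not in the additive submonoid of `ℕ` generated by those four numbers,
equivalently it has no representation `Aq + B(q+q₀) + C(q+2q₀) + D(q+2q₀+1)`. -/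
theorem suzuki_gap (n q₀ q : ℕ) (hn : 1 ≤ n) (hq₀ : q₀ = 2 ^ n) (hq : q = 2 * q₀ ^ 2) :
    ∀ ε : ℕ, ε ≤ 2 * q₀ - 3 →
      (ε * (q + 2 * q₀ + 1) + 1 ∉
        AddSubmonoid.closure ({q, q + q₀, q + 2 * q₀, q + 2 * q₀ + 1} : Set ℕ))
      ∧ ¬ ∃ A B C D : ℕ,
          ε * (q + 2 * q₀ + 1) + 1
            = A * q + B * (q + q₀) + C * (q + 2 * q₀) + D * (q + 2 * q₀ + 1) := by
  intro ε hε
  have hm : 2 ≤ q₀ := by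
    rw [hq₀]
    calc 2 = 2 ^ 1 := by norm_num
      _ ≤ 2 ^ n := Nat.pow_le_pow_right (by norm_num) hn
  have key : ¬ ∃ A B C D : ℕ,
          ε * (q + 2 * q₀ + 1) + 1
            = A * q + B * (q + q₀) + C * (q + 2 * q₀) + D * (q + 2 * q₀ + 1) := by
    rintro ⟨A, B, C, D, h⟩
    rw [hq] at h
    exact suzuki_aux q₀ hm ε A B C D (by omega) h
  refine ⟨fun hmem => key ?_, key⟩
  generalize ε * (q + 2 * q₀ + 1) + 1 = x at hmem
  induction hmem using AddSubmonoid.closure_induction with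
  | mem x hx =>
    simp only [Set.mem_insert_iff, Set.mem_singleton_iff] at hx
    rcases hx with rfl | rfl | rfl | rfl
    · exact ⟨1, 0, 0, 0, by ring⟩
    · exact ⟨0, 1, 0, 0, by ring⟩
    · exact ⟨0, 0, 1, 0, by ring⟩
    · exact ⟨0, 0, 0, 1, by ring⟩
  | zero => exact ⟨0, 0, 0, 0, by ring⟩
  | add x y _ _ hx hy =>
    obtain ⟨A, B, C, D, rfl⟩ := hx
    obtain ⟨A', B', C', D', rfl⟩ := hy
    exact ⟨A + A', B + B', C + C', D + D', by ring⟩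
end

section
/- Let n ≥ 1 be an integer, q₀ = 2ⁿ, q = 2q₀², and g = q₀(q−1). For every integer ε with 0 ≤ ε ≤ 2q₀−3, set n₁ = ε(q+2q₀+1) + 1 and n₂ = 2g − q − 1 − ε(q+2q₀+1). Then n₁ and n₂ both lie in G (the complement in ℕ of the additive submonoid generated by q, q+q₀, q+2q₀, q+2q₀+1), and both (n₁,n₂) and (n₂,n₁) belong to PG, i.e., n₂ < β(n₁) and n₁ < β(n₂). (Since PG equals the set of pure gaps at any two distinct rational places of the Suzuki curve, this says (n₁,n₂) and (n₂,n₁) are pure gaps.) -/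
/-- The Weierstrass semigroup at a rational place of the Suzuki curve with
parameter `q₀` (so `q = 2q₀²`): the additive submonoid of `ℕ` generated by
`q, q+q₀, q+2q₀, q+2q₀+1`. -/
def suzukiH (q₀ : ℕ) : AddSubmonoid ℕ :=
  AddSubmonoid.closure
    ({2 * q₀ ^ 2, 2 * q₀ ^ 2 + q₀, 2 * q₀ ^ 2 + 2 * q₀, 2 * q₀ ^ 2 + 2 * q₀ + 1} : Set ℕ)

/-- For a gap `m`, write `m = r(q+2q₀+1) + m'q₀ + s` with `0 ≤ s ≤ q₀−1`;
`suzukiJ q₀ m` is `s + q₀` if `s ≤ ⌊(m'−1)/2⌋ + 1` (floor division in `ℤ`), and `s`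
otherwise. -/
def suzukiJ (q₀ m : ℕ) : ℤ :=
  let s : ℤ := ((m % (2 * q₀ ^ 2 + 2 * q₀ + 1)) % q₀ : ℕ)
  let m' : ℤ := ((m % (2 * q₀ ^ 2 + 2 * q₀ + 1)) / q₀ : ℕ)
  if s ≤ (m' - 1) / 2 + 1 then s + (q₀ : ℤ) else s

/-- Matthews' bijection `β(m) = 2g − 1 + q − (q−1)j(m) − m` for the Suzuki curve,
where `g = q₀(q−1)` and `q = 2q₀²`. -/
def suzukiBeta (q₀ m : ℕ) : ℤ :=
  2 * ((q₀ : ℤ) * (2 * (q₀ : ℤ) ^ 2 - 1)) - 1 + 2 * (q₀ : ℤ) ^ 2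
    - (2 * (q₀ : ℤ) ^ 2 - 1) * suzukiJ q₀ m - (m : ℤ)

/-- The set of pure gap pairs at two distinct rational places of the Suzuki curve:
`(n₁,n₂)` with `n₁, n₂` gaps, `n₂ < β(n₁)` and `n₁ < β(n₂)`. -/
def suzukiPG (q₀ : ℕ) : Set (ℕ × ℕ) :=
  {p | p.1 ∉ suzukiH q₀ ∧ p.2 ∉ suzukiH q₀ ∧
       (p.2 : ℤ) < suzukiBeta q₀ p.1 ∧ (p.1 : ℤ) < suzukiBeta q₀ p.2}


lemma suzukiH_form (a m : ℕ) (h : m ∈ suzukiH a) :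
    ∃ k u d : ℕ, m = k * (2 * a ^ 2) + u * a + d ∧ 2 * d ≤ u ∧ u ≤ 2 * k := by
  unfold suzukiH at h
  induction h using AddSubmonoid.closure_induction with
  | mem x hx =>
    simp only [Set.mem_insert_iff, Set.mem_singleton_iff] at hx
    rcases hx with rfl | rfl | rfl | rfl
    · exact ⟨1, 0, 0, by ring, by omega, by omega⟩
    · exact ⟨1, 1, 0, by ring, by omega, by omega⟩
    · exact ⟨1, 2, 0, by ring, by omega, by omega⟩
    · exact ⟨1, 2, 1, by ring, by omega, by omega⟩
  | zero => exact ⟨0, 0, 0, by ring, by omega, by omega⟩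
  | add x y _ _ hx hy =>
    obtain ⟨k, u, d, rfl, h1, h2⟩ := hx
    obtain ⟨k', u', d', rfl, h1', h2'⟩ := hy
    exact ⟨k + k', u + u', d + d', by ring, by omega, by omega⟩

/-- Core inequality: with `e ≤ 2a - 2` no representation with `j ≥ 1`. -/
lemma suzuki_core (a e j u d : ℤ) (ha : 2 ≤ a) (he : e ≤ 2 * a - 2)
    (hj : 1 ≤ j) (hd : 0 ≤ d) (hu : 2 * d ≤ u)
    (h : 2 * e * a + e + 1 = j * (2 * a ^ 2) + u * a + d) : False := by
  have hua : 0 ≤ u * a := mul_nonneg (by omega) (by omega)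
  have hj1 : j = 1 := by
    by_contra hne
    have hj2 : 2 ≤ j := by omega
    nlinarith [mul_nonneg (sub_nonneg.2 hj2) (sq_nonneg a),
      mul_nonneg (sub_nonneg.2 he) (by omega : (0:ℤ) ≤ a)]
  subst hj1
  obtain ⟨t, rfl⟩ : ∃ t, e = a + t := ⟨e - a, by ring⟩
  have h' : (2 * t + 1 - u) * a + (t + 1) = d := by linarith
  rcases le_or_gt u (2 * t + 1) with hc | hc
  · have : 0 ≤ (2 * t + 1 - u) * a := mul_nonneg (by omega) (by omega)
    omega
  · have : 0 ≤ (u - (2 * t + 2)) * a := mul_nonneg (by omega) (by omega)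
    nlinarith

/-- Both families of gaps. -/
lemma suzuki_gap1 (a e : ℕ) (ha : 2 ≤ a) (he : e ≤ 2 * a - 2) :
    e * (2 * a ^ 2 + 2 * a + 1) + 1 ∉ suzukiH a := by
  intro h
  obtain ⟨k, u, d, h, h1, h2⟩ := suzukiH_form _ _ h
  zify at *
  have hk : (e : ℤ) + 1 ≤ k := by
    by_contra hne
    have hk : (k : ℤ) ≤ e := by omega
    nlinarith [mul_nonneg (sub_nonneg.2 hk) (sq_nonneg (a : ℤ)),
      mul_nonneg (sub_nonneg.2 hk) (by omega : (0:ℤ) ≤ a),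
      mul_nonneg (sub_nonneg.2 h2) (by omega : (0:ℤ) ≤ a)]
  exact suzuki_core a e (k - e) u d ha (by omega) (by omega) (by omega) h1 (by linarith)

lemma suzuki_gap2 (a e : ℕ) (ha : 2 ≤ a) (he : e ≤ 2 * a - 3) :
    e * (2 * a ^ 2 + 2 * a + 1) + (2 * a + 2) ∉ suzukiH a := by
  intro h
  obtain ⟨k, u, d, h, h1, h2⟩ := suzukiH_form _ _ h
  zify at *
  have hk : (e : ℤ) + 1 ≤ k := by
    by_contra hne
    have hk : (k : ℤ) ≤ e := by omega
    nlinarith [mul_nonneg (sub_nonneg.2 hk) (sq_nonneg (a : ℤ)),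
      mul_nonneg (sub_nonneg.2 hk) (by omega : (0:ℤ) ≤ a),
      mul_nonneg (sub_nonneg.2 h2) (by omega : (0:ℤ) ≤ a)]
  exact suzuki_core a (e + 1) (k - e) u d ha (by omega) (by omega) (by omega) h1 (by linarith)

lemma suzuki_J1 (a e : ℕ) (ha : 2 ≤ a) :
    suzukiJ a (e * (2 * a ^ 2 + 2 * a + 1) + 1) = 1 := by
  have h : (e * (2 * a ^ 2 + 2 * a + 1) + 1) % (2 * a ^ 2 + 2 * a + 1) = 1 := by
    rw [Nat.mul_add_mod_self_right]
    exact Nat.mod_eq_of_lt (by nlinarith)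
  have h1 : 1 % a = 1 := Nat.mod_eq_of_lt (by omega)
  have h2 : 1 / a = 0 := Nat.div_eq_of_lt (by omega)
  simp [suzukiJ, h, h1, h2]

lemma suzuki_J2 (a e : ℕ) (ha : 2 ≤ a) :
    suzukiJ a (e * (2 * a ^ 2 + 2 * a + 1) + (2 * a + 2)) = 2 := by
  have h : (e * (2 * a ^ 2 + 2 * a + 1) + (2 * a + 2)) % (2 * a ^ 2 + 2 * a + 1)
      = 2 * a + 2 := by
    rw [Nat.mul_add_mod_self_right]
    exact Nat.mod_eq_of_lt (by nlinarith)
  rcases Nat.lt_or_ge 2 a with h3 | h3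
  · have h1 : (2 * a + 2) % a = 2 := by
      rw [Nat.mul_add_mod_self_right]
      exact Nat.mod_eq_of_lt h3
    have h2 : (2 * a + 2) / a = 2 := by
      rw [Nat.div_eq_iff (by omega)]; omega
    simp [suzukiJ, h, h1, h2]
  · obtain rfl : a = 2 := by omega
    unfold suzukiJ
    rw [h]
    norm_num

/-- For `q₀ = 2ⁿ`, `q = 2q₀²`, `g = q₀(q−1)` and `0 ≤ ε ≤ 2q₀−3`, the pair
`(n₁, n₂) = (ε(q+2q₀+1)+1, 2g−q−1−ε(q+2q₀+1))` and its reverse are pure gaps at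
any two distinct rational places of the Suzuki curve. -/
theorem suzuki_pure_gaps (n q₀ q g : ℕ)
    (hn : 1 ≤ n) (hq₀ : q₀ = 2 ^ n) (hq : q = 2 * q₀ ^ 2) (hg : g = q₀ * (q - 1)) :
    ∀ ε : ℕ, ε ≤ 2 * q₀ - 3 → ∀ n₁ n₂ : ℕ,
      n₁ = ε * (q + 2 * q₀ + 1) + 1 →
      (n₂ : ℤ) = 2 * (g : ℤ) - q - 1 - ε * ((q : ℤ) + 2 * q₀ + 1) →
      n₁ ∉ suzukiH q₀ ∧ n₂ ∉ suzukiH q₀ ∧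
      (n₁, n₂) ∈ suzukiPG q₀ ∧ (n₂, n₁) ∈ suzukiPG q₀ := by
  intro ε hε n₁ n₂ h₁ h₂
  have ha : 2 ≤ q₀ := by
    rw [hq₀]
    calc 2 = 2 ^ 1 := by norm_num
      _ ≤ 2 ^ n := Nat.pow_le_pow_right (by norm_num) hn
  have hgz : (g : ℤ) = q₀ * (2 * (q₀ : ℤ) ^ 2 - 1) := by
    have : 1 ≤ q := by rw [hq]; nlinarith
    rw [hg]; push_cast [Nat.cast_sub this]; rw [hq]; push_cast; ring
  obtain ⟨δ, hδ⟩ : ∃ δ, δ + ε = 2 * q₀ - 3 := ⟨2 * q₀ - 3 - ε, by omega⟩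
  have hδz : (ε : ℤ) = 2 * q₀ - 3 - δ := by omega
  clear hq₀
  subst hq
  have e₂ : n₂ = δ * (2 * q₀ ^ 2 + 2 * q₀ + 1) + (2 * q₀ + 2) := by
    zify
    rw [h₂, hgz, hδz]; push_cast; ring
  have g₁ : n₁ ∉ suzukiH q₀ := h₁ ▸ suzuki_gap1 q₀ ε ha (by omega)
  have g₂ : n₂ ∉ suzukiH q₀ := e₂ ▸ suzuki_gap2 q₀ δ ha (by omega)
  have hsum : (n₁ : ℤ) + n₂ = 2 * g - 2 * (q₀ : ℤ) ^ 2 := by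
    rw [h₂, h₁]; push_cast; ring
  have j₁ : suzukiJ q₀ n₁ = 1 := h₁ ▸ suzuki_J1 q₀ ε ha
  have j₂ : suzukiJ q₀ n₂ = 2 := e₂ ▸ suzuki_J2 q₀ δ ha
  have hpos : 0 < (q₀ : ℤ) ^ 2 := by positivity
  have b₁ : (n₂ : ℤ) < suzukiBeta q₀ n₁ := by
    unfold suzukiBeta; rw [j₁, ← hgz]; linarith
  have b₂ : (n₁ : ℤ) < suzukiBeta q₀ n₂ := by
    unfold suzukiBeta; rw [j₂, ← hgz]; linarith
  exact ⟨g₁, g₂, ⟨g₁, g₂, b₁, b₂⟩, ⟨g₂, g₁, b₂, b₁⟩⟩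
end

section
/- Let n ≥ 2 be an integer, q₀ = 2ⁿ (so q₀ > 2), q = 2q₀², and g = q₀(q−1). For nonnegative integers n₁, n₂ with n₁ + n₂ = 2g − q, the pair (n₁,n₂) belongs to PG if and only if there exists an integer ε with 0 ≤ ε ≤ 2q₀−3 such that either (n₁,n₂) = (ε(q+2q₀+1)+1, 2g−q−1−ε(q+2q₀+1)) or (n₂,n₁) = (ε(q+2q₀+1)+1, 2g−q−1−ε(q+2q₀+1)). (Since PG equals the set of pure gaps at any two distinct rational places of the Suzuki curve, this characterizes all pure gap pairs of maximal sum 2g−q.) -/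
lemma suz_mem (Q m : ℕ) (h : m ∈ suzukiH Q) : ∃ a b c d : ℕ,
    m = a * (2 * Q ^ 2) + b * (2 * Q ^ 2 + Q) + c * (2 * Q ^ 2 + 2 * Q)
      + d * (2 * Q ^ 2 + 2 * Q + 1) := by
  unfold suzukiH at h
  induction h using AddSubmonoid.closure_induction with
  | mem x hx =>
    simp only [Set.mem_insert_iff, Set.mem_singleton_iff] at hx
    rcases hx with h | h | h | h
    · exact ⟨1, 0, 0, 0, by rw [h]; ring⟩
    · exact ⟨0, 1, 0, 0, by rw [h]; ring⟩
    · exact ⟨0, 0, 1, 0, by rw [h]; ring⟩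
    · exact ⟨0, 0, 0, 1, by rw [h]; ring⟩
  | zero => exact ⟨0, 0, 0, 0, by ring⟩
  | add x y _ _ hx hy =>
    obtain ⟨a, b, c, d, rfl⟩ := hx
    obtain ⟨a', b', c', d', rfl⟩ := hy
    exact ⟨a + a', b + b', c + c', d + d', by ring⟩

/-- `αN + 1` and `αN + 2q₀ + 2` are gaps for `α ≤ 2q₀ - 3`. -/
lemma suz_gap (Q m α e : ℕ) (hQ : 4 ≤ Q) (hα : α + 3 ≤ 2 * Q) (he : e ≤ 1)
    (hm : m = α * (2 * Q ^ 2 + 2 * Q + 1) + 1 + e * (2 * Q + 1)) : m ∉ suzukiH Q := by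
  intro h
  obtain ⟨a, b, c, d, h⟩ := suz_mem Q m h
  rw [hm] at h
  zify at h hQ hα he
  have ha : (0 : ℤ) ≤ a := by positivity
  have hb : (0 : ℤ) ≤ b := by positivity
  have hc : (0 : ℤ) ≤ c := by positivity
  have hd : (0 : ℤ) ≤ d := by positivity
  have he0 : (0 : ℤ) ≤ e := by positivity
  have hα0 : (0 : ℤ) ≤ α := by positivity
  generalize (Q : ℤ) = Q at *
  generalize (a : ℤ) = a at *
  generalize (b : ℤ) = b at *
  generalize (c : ℤ) = c at *
  generalize (d : ℤ) = d at *
  generalize (e : ℤ) = e at *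
  generalize (α : ℤ) = α at *
  obtain ⟨t, ht⟩ : ∃ t, t = a + b + c + d - α := ⟨_, rfl⟩
  obtain ⟨z, hz⟩ : ∃ z, z = 2 * Q * t + 2 * t - 2 * e - (2 * a + b) := ⟨_, rfl⟩
  have hd' : d = t + α - a - b - c := by linarith
  have hy : a + b + c = t - 1 - e + Q * z := by
    subst hz hd'
    linear_combination h
  have ht1 : 1 ≤ t := by
    by_contra hcon
    have h1 : t ≤ 0 := by omega
    have h2 : t * (2 * Q ^ 2 + 2 * Q + 1) = (2 * Q + 1) * a + (Q + 1) * b + c + 1 + e * (2 * Q + 1) := by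
      rw [ht]; linear_combination -h
    have h3 : t * (2 * Q ^ 2 + 2 * Q + 1) ≤ 0 := mul_nonpos_of_nonpos_of_nonneg h1 (by positivity)
    have : 0 ≤ (2 * Q + 1) * a + (Q + 1) * b + c + e * (2 * Q + 1) := by positivity
    linarith
  have hz1 : z ≤ 1 := by
    by_contra hcon
    have : 2 ≤ z := by omega
    nlinarith
  have hx : 2 * Q * t + 2 ≤ (2 * Q + 1) * z := by nlinarith
  nlinarith

lemma suz_J (Q m : ℕ) (hQ : 4 ≤ Q) : suzukiJ Q m ≤ 2 ↔
    (m % (2 * Q ^ 2 + 2 * Q + 1) = 1 ∨ m % (2 * Q ^ 2 + 2 * Q + 1) = 2 ∨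
     m % (2 * Q ^ 2 + 2 * Q + 1) = Q + 2 ∨ m % (2 * Q ^ 2 + 2 * Q + 1) = 2 * Q + 2) := by
  unfold suzukiJ
  generalize m % (2 * Q ^ 2 + 2 * Q + 1) = x
  have h1 := Nat.div_add_mod x Q
  have h2 : x % Q < Q := Nat.mod_lt _ (by omega)
  dsimp only
  constructor
  · intro h
    generalize x / Q = u at *
    generalize x % Q = v at *
    have : (v = 1 ∧ u = 0) ∨ (v = 2 ∧ u ≤ 2) := by split_ifs at h <;> omega
    rcases this with ⟨rfl, rfl⟩ | ⟨rfl, hu⟩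
    · omega
    · interval_cases u <;> omega
  · have key : ∀ u v, x = Q * u + v → v < Q → x / Q = u ∧ x % Q = v := by
      rintro u v rfl hv
      constructor
      · rw [Nat.mul_add_div (by omega), Nat.div_eq_of_lt hv]; omega
      · rw [Nat.mul_add_mod, Nat.mod_eq_of_lt hv]
    rintro (h | h | h | h)
    · obtain ⟨h3, h4⟩ := key 0 1 (by omega) (by omega)
      rw [h3, h4]; norm_num
    · obtain ⟨h3, h4⟩ := key 0 2 (by omega) (by omega)
      rw [h3, h4]; norm_num
    · obtain ⟨h3, h4⟩ := key 1 2 (by omega) (by omega)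
      rw [h3, h4]; norm_num
    · obtain ⟨h3, h4⟩ := key 2 2 (by omega) (by omega)
      rw [h3, h4]; norm_num

lemma suz_beta (Q m k : ℕ) (hQ : 4 ≤ Q)
    (hs : (m : ℤ) + k = 2 * (Q * (2 * (Q : ℤ) ^ 2 - 1)) - 2 * (Q : ℤ) ^ 2) :
    (k : ℤ) < suzukiBeta Q m ↔ suzukiJ Q m ≤ 2 := by
  unfold suzukiBeta
  generalize suzukiJ Q m = j
  zify at hQ
  constructor
  · intro h
    by_contra hc
    have : 3 ≤ j := by omega
    nlinarith
  · intro h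
    nlinarith

lemma suz_pair (Q n₁ n₂ : ℕ) (hQ : 4 ≤ Q)
    (hs : n₁ + n₂ = (2 * Q - 3) * (2 * Q ^ 2 + 2 * Q + 1) + (2 * Q + 3)) :
    (suzukiJ Q n₁ ≤ 2 ∧ suzukiJ Q n₂ ≤ 2) ↔
      ∃ ε δ : ℕ, ε + δ = 2 * Q - 3 ∧
       ((n₁ = ε * (2 * Q ^ 2 + 2 * Q + 1) + 1 ∧ n₂ = δ * (2 * Q ^ 2 + 2 * Q + 1) + 1 + 1 * (2 * Q + 1)) ∨
        (n₂ = ε * (2 * Q ^ 2 + 2 * Q + 1) + 1 ∧ n₁ = δ * (2 * Q ^ 2 + 2 * Q + 1) + 1 + 1 * (2 * Q + 1))) := by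
  rw [suz_J Q n₁ hQ, suz_J Q n₂ hQ]
  have hN : 4 * Q + 5 ≤ 2 * Q ^ 2 + 2 * Q + 1 := by nlinarith
  generalize 2 * Q ^ 2 + 2 * Q + 1 = N at *
  have d1 := Nat.div_add_mod n₁ N
  have d2 := Nat.div_add_mod n₂ N
  constructor
  · rintro ⟨h1, h2⟩
    have e : n₁ % N + n₂ % N = 2 * Q + 3 := by
      have a1 : (n₁ + n₂) % N = 2 * Q + 3 := by
        rw [hs, Nat.mul_add_mod_self_right, Nat.mod_eq_of_lt (by omega)]
      rw [Nat.add_mod, Nat.mod_eq_of_lt (by omega)] at a1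
      exact a1
    have e2 : n₁ / N + n₂ / N = 2 * Q - 3 := by
      have : N * (n₁ / N + n₂ / N) = N * (2 * Q - 3) := by
        rw [mul_add, mul_comm N (2 * Q - 3)]; omega
      exact Nat.eq_of_mul_eq_mul_left (by omega) this
    have : (n₁ % N = 1 ∧ n₂ % N = 2 * Q + 2) ∨ (n₂ % N = 1 ∧ n₁ % N = 2 * Q + 2) := by omega
    rcases this with ⟨h3, h4⟩ | ⟨h3, h4⟩
    · refine ⟨n₁ / N, n₂ / N, e2, Or.inl ⟨?_, ?_⟩⟩ <;> rw [mul_comm] <;> omega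
    · refine ⟨n₂ / N, n₁ / N, by omega, Or.inr ⟨?_, ?_⟩⟩ <;> rw [mul_comm] <;> omega
  · have key : ∀ a r, r < N → (a * N + r) % N = r := fun a r h => by
      rw [Nat.mul_add_mod_self_right, Nat.mod_eq_of_lt h]
    rintro ⟨ε, δ, -, ⟨h1, h2⟩ | ⟨h1, h2⟩⟩ <;> rw [add_assoc] at h2 <;> rw [h1, h2] <;>
      rw [key _ _ (by omega), key _ _ (by omega)] <;> omega

/-- Characterization of pure gap pairs of maximal sum. -/
theorem suzuki_pure_gaps_max_sum_characterization (n q₀ q g : ℕ)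
    (hn : 2 ≤ n) (hq₀ : q₀ = 2 ^ n) (hq : q = 2 * q₀ ^ 2) (hg : g = q₀ * (q - 1))
    (n₁ n₂ : ℕ) (hsum : (n₁ : ℤ) + (n₂ : ℤ) = 2 * (g : ℤ) - q) :
    (n₁, n₂) ∈ suzukiPG q₀ ↔
      ∃ ε : ℕ, ε ≤ 2 * q₀ - 3 ∧
        (((n₁ : ℤ) = ε * ((q : ℤ) + 2 * q₀ + 1) + 1 ∧
            (n₂ : ℤ) = 2 * (g : ℤ) - q - 1 - ε * ((q : ℤ) + 2 * q₀ + 1)) ∨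
         ((n₂ : ℤ) = ε * ((q : ℤ) + 2 * q₀ + 1) + 1 ∧
            (n₁ : ℤ) = 2 * (g : ℤ) - q - 1 - ε * ((q : ℤ) + 2 * q₀ + 1))) := by
  have hQ : 4 ≤ q₀ := by
    rw [hq₀]
    calc 4 = 2 ^ 2 := by norm_num
      _ ≤ 2 ^ n := Nat.pow_le_pow_right (by norm_num) hn
  have hg' : (g : ℤ) = q₀ * (2 * (q₀ : ℤ) ^ 2 - 1) := by
    have : 1 ≤ q := by rw [hq]; nlinarith
    rw [hg]
    push_cast [Nat.cast_sub this]
    rw [hq]; push_cast; ring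
  have hq' : (q : ℤ) = 2 * (q₀ : ℤ) ^ 2 := by rw [hq]; push_cast; ring
  rw [hg', hq'] at hsum ⊢
  have hs : n₁ + n₂ = (2 * q₀ - 3) * (2 * q₀ ^ 2 + 2 * q₀ + 1) + (2 * q₀ + 3) := by
    have : 3 ≤ 2 * q₀ := by omega
    zify [this]
    rw [hsum]; ring
  have hp := suz_pair q₀ n₁ n₂ hQ hs
  have b1 := suz_beta q₀ n₁ n₂ hQ hsum
  have b2 := suz_beta q₀ n₂ n₁ hQ (by rw [add_comm]; exact hsum)
  have hpg : (n₁, n₂) ∈ suzukiPG q₀ ↔ n₁ ∉ suzukiH q₀ ∧ n₂ ∉ suzukiH q₀ ∧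
      suzukiJ q₀ n₁ ≤ 2 ∧ suzukiJ q₀ n₂ ≤ 2 := by
    rw [← b1, ← b2]; rfl
  rw [hpg]
  constructor
  · rintro ⟨-, -, h⟩
    obtain ⟨ε, δ, he, h⟩ := hp.1 h
    refine ⟨ε, by omega, ?_⟩
    rcases h with ⟨h1, -⟩ | ⟨h1, -⟩
    · left
      zify at h1
      exact ⟨h1, by linarith⟩
    · right
      zify at h1
      exact ⟨h1, by linarith⟩
  · rintro ⟨ε, he, h⟩
    obtain ⟨δ, hδ⟩ : ∃ δ, ε + δ = 2 * q₀ - 3 := ⟨2 * q₀ - 3 - ε, by omega⟩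
    rw [← hδ, add_mul] at hs
    have h' : ((n₁ = ε * (2 * q₀ ^ 2 + 2 * q₀ + 1) + 1 ∧ n₂ = δ * (2 * q₀ ^ 2 + 2 * q₀ + 1) + 1 + 1 * (2 * q₀ + 1)) ∨
        (n₂ = ε * (2 * q₀ ^ 2 + 2 * q₀ + 1) + 1 ∧ n₁ = δ * (2 * q₀ ^ 2 + 2 * q₀ + 1) + 1 + 1 * (2 * q₀ + 1))) := by
      rcases h with ⟨h1, -⟩ | ⟨h1, -⟩
      · left
        have h2 : n₁ = ε * (2 * q₀ ^ 2 + 2 * q₀ + 1) + 1 := by exact_mod_cast h1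
        exact ⟨h2, by omega⟩
      · right
        have h2 : n₂ = ε * (2 * q₀ ^ 2 + 2 * q₀ + 1) + 1 := by exact_mod_cast h1
        exact ⟨h2, by omega⟩
    have hJ := hp.2 ⟨ε, δ, hδ, h'⟩
    rcases h' with ⟨h1, h2⟩ | ⟨h1, h2⟩
    · exact ⟨suz_gap q₀ n₁ ε 0 hQ (by omega) (by omega) (by rw [h1]; ring),
        suz_gap q₀ n₂ δ 1 hQ (by omega) (by omega) h2, hJ⟩
    · exact ⟨suz_gap q₀ n₁ δ 1 hQ (by omega) (by omega) h2,
        suz_gap q₀ n₂ ε 0 hQ (by omega) (by omega) (by rw [h1]; ring), hJ⟩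
end
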